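/- For every ε with 0 < ε ≤ 1 and every q̃ with 3/4 < q̃ < 1, let v = √(v₊²(q̃)). Then the matrix M = B^#(v, ε)⁻¹·A(v) satisfies det(M) > 0 and trace(M) < 0; consequently every complex eigenvalue of M has strictly negative real part (i.e., the rest point ψ₊(q̃) of the profile equations is an attractor). -/

import Mathlib

/-- `v₊²(q̃) = ((2q̃ − 1) − √(q̃(4q̃ − 3)))/(4(1 − q̃))`. -/
noncomputable def vplusSq (q : ℝ) : ℝ :=
  ((2 * q - 1) - Real.sqrt (q * (4 * q - 3))) / (4 * (1 - q))

/-- `v₋²(q̃) = ((2q̃ − 1) + √(q̃(4q̃ − 3)))/(4(1 − q̃))`. -/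
noncomputable def vminusSq (q : ℝ) : ℝ :=
  ((2 * q - 1) + Real.sqrt (q * (4 * q - 3))) / (4 * (1 - q))

/-- `u = √(1 + v²)`. -/
noncomputable def uu (v : ℝ) : ℝ := Real.sqrt (1 + v ^ 2)

/-- The dissipation matrix `B^#(v, ε) = ε·B_visc − B₁ − (9ε/(4 − ε))·B₂`. -/
noncomputable def Bsharp (v ε : ℝ) : Matrix (Fin 2) (Fin 2) ℝ :=
  ε • !![(uu v) ^ 2 * v ^ 2, -(uu v) ^ 3 * v; -(uu v) ^ 3 * v, (uu v) ^ 4]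
    - !![16 * (uu v) ^ 2 * v ^ 2, -4 * (uu v) * v * (4 * v ^ 2 + 1);
         -4 * (uu v) * v * (4 * v ^ 2 + 1), (4 * v ^ 2 + 1) ^ 2]
    - (9 * ε / (4 - ε)) • !![((uu v) ^ 2 + v ^ 2) ^ 2, -2 * ((uu v) ^ 2 + v ^ 2) * (uu v) * v;
         -2 * ((uu v) ^ 2 + v ^ 2) * (uu v) * v, 4 * (uu v) ^ 2 * v ^ 2]

/-- The matrix `A(v)` of the scaled linearization. -/
noncomputable def Amat (v : ℝ) : Matrix (Fin 2) (Fin 2) ℝ :=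
  !![v * (6 * v ^ 2 + 5), -(uu v) * (6 * v ^ 2 + 1);
     -(uu v) * (6 * v ^ 2 + 1), 3 * v * (2 * v ^ 2 + 1)]

theorem one_eighth_lt_vplusSq {q : ℝ} (hq1 : 3 / 4 < q) (hq2 : q < 1) : 1 / 8 < vplusSq q := by
  have h : Real.sqrt (q * (4 * q - 3)) < (5 * q - 3) / 2 := by
    rw [Real.sqrt_lt' (by linarith)]
    nlinarith [mul_pos (sub_pos.2 hq2) (sub_pos.2 hq2)]
  rw [vplusSq, lt_div_iff₀ (by linarith)]
  linarith

theorem vplusSq_lt_half {q : ℝ} (hq1 : 3 / 4 < q) (hq2 : q < 1) : vplusSq q < 1 / 2 := by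
  have h : 4 * q - 3 < Real.sqrt (q * (4 * q - 3)) := by
    rw [Real.lt_sqrt (by linarith)]
    nlinarith [mul_pos (sub_pos.2 hq1) (sub_pos.2 hq2)]
  rw [vplusSq, div_lt_iff₀ (by linarith)]
  linarith

theorem uu_sq (v : ℝ) : uu v ^ 2 = 1 + v ^ 2 := Real.sq_sqrt (by positivity)

theorem det_Amat (v : ℝ) : (Amat v).det = 2 * v ^ 2 - 1 := by
  rw [Amat, Matrix.det_fin_two_of]
  linear_combination (-(6 * v ^ 2 + 1) ^ 2) * uu_sq v

theorem det_Bsharp {v ε : ℝ} (hε : ε ≠ 4) :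
    (Bsharp v ε).det = 9 * ε / (4 - ε) * (1 - 8 * v ^ 2 - ε * (1 + v ^ 2)) := by
  have hk : 9 * ε / (4 - ε) * (4 - ε) = 9 * ε := div_mul_cancel₀ _ (sub_ne_zero.2 hε.symm)
  have h4 : uu v ^ 4 = (1 + v ^ 2) ^ 2 := by rw [← uu_sq]; ring
  have h3 : uu v ^ 3 = uu v * (1 + v ^ 2) := by rw [← uu_sq]; ring
  simp only [Bsharp, Matrix.det_fin_two, Matrix.sub_apply, Matrix.smul_apply, Matrix.of_apply,
    Matrix.cons_val', Matrix.cons_val_zero, Matrix.cons_val_one, Matrix.cons_val_fin_one,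
    smul_eq_mul, neg_mul]
  generalize 9 * ε / (4 - ε) = k at hk ⊢
  rw [h3, h4, uu_sq]
  ring_nf
  rw [uu_sq]
  linear_combination ((1 + v ^ 2) * v ^ 2) * hk

theorem trace_adjugate_Bsharp_mul_Amat (v ε : ℝ) :
    ((Bsharp v ε).adjugate * Amat v).trace =
      v * (3 * ε * (1 + v ^ 2) + (3 + 9 * ε / (4 - ε)) * (1 - 2 * v ^ 2)) := by
  have h4 : uu v ^ 4 = (1 + v ^ 2) ^ 2 := by rw [← uu_sq]; ring
  have h3 : uu v ^ 3 = uu v * (1 + v ^ 2) := by rw [← uu_sq]; ring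
  simp only [Bsharp, Amat, Matrix.adjugate_fin_two, Matrix.trace_fin_two, Matrix.mul_apply,
    Fin.sum_univ_two, Matrix.sub_apply, Matrix.smul_apply, Matrix.of_apply,
    Matrix.cons_val', Matrix.cons_val_zero, Matrix.cons_val_one, Matrix.cons_val_fin_one,
    smul_eq_mul, neg_mul]
  generalize 9 * ε / (4 - ε) = k
  rw [h3, h4, uu_sq]
  ring_nf
  rw [uu_sq]
  ring

theorem re_neg_of_isRoot_charpoly {M : Matrix (Fin 2) (Fin 2) ℝ} (hdet : 0 < M.det)
    (htr : M.trace < 0) {μ : ℂ} (hμ : (M.map (algebraMap ℝ ℂ)).charpoly.IsRoot μ) :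
    μ.re < 0 := by
  rw [Matrix.charpoly_map, Matrix.charpoly_fin_two, Polynomial.IsRoot.def] at hμ
  simp only [Polynomial.map_add, Polynomial.map_sub, Polynomial.map_mul, Polynomial.map_pow,
    Polynomial.map_X, Polynomial.map_C, Polynomial.eval_add, Polynomial.eval_sub,
    Polynomial.eval_mul, Polynomial.eval_pow, Polynomial.eval_X, Polynomial.eval_C,
    Complex.coe_algebraMap] at hμ
  have hre := congrArg Complex.re hμ
  have him := congrArg Complex.im hμ
  simp [pow_two] at hre him
  by_contra! h
  have hy : μ.im = 0 := by
    have : μ.im * (2 * μ.re - M.trace) = 0 := by linear_combination him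
    rcases mul_eq_zero.1 this with h0 | h0
    · exact h0
    · linarith
  rw [hy] at hre
  nlinarith [mul_nonneg h (neg_nonneg.2 htr.le)]

/-- For `0 < ε ≤ 1` and `3/4 < q̃ < 1`, with `v = √(v₊²(q̃))`, the matrix
`M = B^#(v, ε)⁻¹·A(v)` satisfies `det M > 0` and `trace M < 0`, and every complex
eigenvalue of `M` has strictly negative real part: `ψ₊(q̃)` is an attractor. -/
theorem psi_plus_attractor (ε q : ℝ) (hε0 : 0 < ε) (hε1 : ε ≤ 1)
    (hq1 : 3 / 4 < q) (hq2 : q < 1) :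
    0 < ((Bsharp (Real.sqrt (vplusSq q)) ε)⁻¹ * Amat (Real.sqrt (vplusSq q))).det ∧
    Matrix.trace ((Bsharp (Real.sqrt (vplusSq q)) ε)⁻¹ * Amat (Real.sqrt (vplusSq q))) < 0 ∧
    ∀ μ : ℂ,
      (Matrix.charpoly
        (((Bsharp (Real.sqrt (vplusSq q)) ε)⁻¹ * Amat (Real.sqrt (vplusSq q))).map
          (algebraMap ℝ ℂ))).IsRoot μ → μ.re < 0 := by
  have hw1 := one_eighth_lt_vplusSq hq1 hq2
  have hw2 := vplusSq_lt_half hq1 hq2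
  have hw : 0 < vplusSq q := by linarith
  have hv := Real.sqrt_pos.2 hw
  rw [← Real.sq_sqrt hw.le] at hw1 hw2
  generalize Real.sqrt (vplusSq q) = v at *
  have hk : 0 < 9 * ε / (4 - ε) := div_pos (by linarith) (by linarith)
  have hB : (Bsharp v ε).det < 0 := by
    rw [det_Bsharp (by linarith)]
    exact mul_neg_of_pos_of_neg hk (by nlinarith [mul_pos hε0 (show 0 < 1 + v ^ 2 by positivity)])
  have hdet : 0 < ((Bsharp v ε)⁻¹ * Amat v).det := by
    rw [Matrix.det_mul, Matrix.det_nonsing_inv, Ring.inverse_eq_inv', det_Amat]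
    exact mul_pos_of_neg_of_neg (inv_lt_zero.2 hB) (by linarith)
  have htr : ((Bsharp v ε)⁻¹ * Amat v).trace < 0 := by
    rw [Matrix.inv_def, Ring.inverse_eq_inv', Matrix.smul_mul, Matrix.trace_smul,
      trace_adjugate_Bsharp_mul_Amat, smul_eq_mul]
    have h2 : 0 < 1 - 2 * v ^ 2 := by linarith
    exact mul_neg_of_neg_of_pos (inv_lt_zero.2 hB) (by positivity)
  exact ⟨hdet, htr, fun μ hμ => re_neg_of_isRoot_charpoly hdet htr hμ⟩
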